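/- Let S, A be finite, r: S×A → [0,1], γ ∈ (0,1), and P = ⊗_{s,a}P_{s,a} an (s,a)-rectangular uncertainty set with each P_{s,a} nonempty and compact. Let θ ↦ π_θ be a policy parameterization on ℝ^n such that each map θ ↦ π_θ(a|s) is differentiable, and define the robust objective J(θ) = min over stationary kernels κ with κ(·|s,a) ∈ P_{s,a} of ρᵀV_κ^{π_θ}. Fix θ₀, set π = π_{θ₀}, let κ_π be a worst-case kernel for π, and define g := (1/(1−γ))·Σ_s d_ρ^{π,κ_π}(s)·Σ_a Q^π(s,a)·∇_θ π_θ(a|s)|_{θ=θ₀} ∈ ℝ^n. Then g is a Fréchet supergradient of J at θ₀: limsup_{θ → θ₀, θ ≠ θ₀} (J(θ) − J(θ₀) − ⟨g, θ−θ₀⟩)/‖θ − θ₀‖ ≤ 0. Moreover g equals (1/(1−γ))·Σ_s d_ρ^{π,κ_π}(s)·Σ_a A^π(s,a)·∇_θ π_θ(a|s)|_{θ=θ₀}. -/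

import Mathlib

open Finset Matrix Filter Topology

/-- A subsolution of the discounted equation of a stochastic matrix is bounded by the constant
solution. -/
theorem le_div_of_le_add_discounted {S : Type*} [Fintype S] [DecidableEq S] {P : Matrix S S ℝ}
    (hP : P ∈ rowStochastic ℝ S) {γ : ℝ} (hγ0 : 0 ≤ γ) (hγ1 : γ < 1) {D : S → ℝ} {c : ℝ}
    (hD : ∀ s, D s ≤ c + γ * ∑ s', P s s' * D s') (s : S) : D s ≤ c / (1 - γ) := by
  obtain ⟨m, -, hm⟩ := Finset.exists_max_image univ D ⟨s, mem_univ s⟩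
  have h1 : ∑ s', P m s' * D s' ≤ D m := by
    calc ∑ s', P m s' * D s' ≤ ∑ s', P m s' * D m :=
          sum_le_sum fun s' _ => mul_le_mul_of_nonneg_left (hm s' (mem_univ _))
            (nonneg_of_mem_rowStochastic hP)
      _ = D m := by rw [← sum_mul, sum_row_of_mem_rowStochastic hP, one_mul]
  refine (hm s (mem_univ s)).trans ?_
  rw [le_div_iff₀ (by linarith)]
  nlinarith [hD m, mul_le_mul_of_nonneg_left h1 hγ0]

/-- The Neumann series of a matrix with bounded powers solves the discounted equation. -/
theorem tsum_discounted_eq {S : Type*} [Fintype S] [DecidableEq S] {M : Matrix S S ℝ}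
    (hM : ∀ t i j, |(M ^ t) i j| ≤ 1) {γ : ℝ} (hγ0 : 0 ≤ γ) (hγ1 : γ < 1) (v : S → ℝ) (i : S) :
    ∑' t : ℕ, γ ^ t * ((M ^ t) *ᵥ v) i =
      v i + γ * ∑ j, M i j * ∑' t : ℕ, γ ^ t * ((M ^ t) *ᵥ v) j := by
  have hs : ∀ j, Summable fun t : ℕ => γ ^ t * ((M ^ t) *ᵥ v) j := by
    intro j
    refine Summable.of_norm_bounded
      ((summable_geometric_of_lt_one hγ0 hγ1).mul_right (∑ k, |v k|)) fun t => ?_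
    rw [Real.norm_eq_abs, abs_mul, abs_of_nonneg (pow_nonneg hγ0 t)]
    refine mul_le_mul_of_nonneg_left ?_ (pow_nonneg hγ0 t)
    refine (abs_sum_le_sum_abs _ _).trans (sum_le_sum fun k _ => ?_)
    rw [abs_mul]
    exact mul_le_of_le_one_left (abs_nonneg _) (hM t j k)
  rw [(hs i).tsum_eq_zero_add]
  simp only [pow_zero, one_mul, one_mulVec]
  congr 1
  simp_rw [← tsum_mul_left]
  rw [← Summable.tsum_finsetSum fun j _ => (hs j).mul_left (M i j), ← tsum_mul_left]
  refine tsum_congr fun t => ?_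
  rw [pow_succ' M, ← mulVec_mulVec, pow_succ, mulVec, dotProduct, mul_sum, mul_sum]
  exact sum_congr rfl fun j _ => by ring

theorem abs_pow_apply_le_one_of_mem_rowStochastic {S : Type*} [Fintype S] [DecidableEq S]
    {P : Matrix S S ℝ} (hP : P ∈ rowStochastic ℝ S) (t : ℕ) (i j : S) : |(P ^ t) i j| ≤ 1 := by
  have h := pow_mem hP t
  rw [abs_of_nonneg (nonneg_of_mem_rowStochastic h)]
  exact le_one_of_mem_rowStochastic h

/-- If `D` solves `D = b + γ P D` and `d` is the discounted occupation vector `d = ρ + γ Pᵀ d`,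
then `ρ` integrates `D` as `d` integrates `b`. -/
theorem sum_mul_eq_sum_mul_of_discounted {S : Type*} [Fintype S] {P : Matrix S S ℝ} {γ : ℝ}
    {ρ d D b : S → ℝ} (hd : ∀ s, d s = ρ s + γ * ∑ s', P s' s * d s')
    (hD : ∀ s, D s = b s + γ * ∑ s', P s s' * D s') :
    ∑ s, ρ s * D s = ∑ s, d s * b s := by
  have hρ : ∀ s, ρ s = d s - γ * ∑ s', P s' s * d s' := fun s => by linarith [hd s]
  have hb : ∀ s, b s = D s - γ * ∑ s', P s s' * D s' := fun s => by linarith [hD s]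
  simp_rw [hρ, hb, sub_mul, mul_sub, sum_sub_distrib, mul_sum, sum_mul]
  congr 1
  rw [sum_comm]
  exact sum_congr rfl fun s _ => sum_congr rfl fun s' _ => by ring

/-- Product rule when the differentiable factor vanishes at the point and the other factor is
only continuous there. -/
theorem HasFDerivAt.mul_continuousAt_of_eq_zero {E : Type*} [NormedAddCommGroup E]
    [NormedSpace ℝ E] {f h : E → ℝ} {f' : E →L[ℝ] ℝ} {x : E} (hf : HasFDerivAt f f' x)
    (h0 : f x = 0) (hh : ContinuousAt h x) :
    HasFDerivAt (fun y => f y * h y) (h x • f') x := by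
  have h1 : HasFDerivAt (fun y => f y * h x) (h x • f') x := hf.mul_const (h x)
  have h2 : HasFDerivAt (fun y => f y * (h y - h x)) (0 : E →L[ℝ] ℝ) x := by
    rw [hasFDerivAt_iff_isLittleO]
    have hO : f =O[𝓝 x] fun y => y - x := by simpa [h0] using hf.isBigO_sub
    have ho : (fun y => h y - h x) =o[𝓝 x] fun _ => (1 : ℝ) := by
      rw [Asymptotics.isLittleO_one_iff]
      exact tendsto_sub_nhds_zero_iff.2 hh
    simpa [h0] using hO.norm_right.mul_isLittleO ho
  refine ((h1.add h2).congr_of_eventuallyEq (.of_forall fun y => ?_)).congr_fderiv (add_zero _)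
  simp only [Pi.add_apply]
  ring

/-- A real `limsup` is nonpositive as soon as every positive number is an eventual upper bound; no
boundedness below is needed, since `sInf` of an unbounded set of reals is `0`. -/
theorem Real.limsup_le_zero_of_forall_eventually_le {α : Type*} {F : Filter α} {f : α → ℝ}
    (h : ∀ ε > 0, ∀ᶠ x in F, f x ≤ ε) : F.limsup f ≤ 0 := by
  rw [Filter.limsup_eq]
  by_cases hb : BddBelow {a | ∀ᶠ x in F, f x ≤ a}
  · exact le_of_forall_pos_le_add fun ε hε => by simpa using csInf_le hb (h ε hε)
  · exact (Real.sInf_of_not_bddBelow hb).le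

theorem sum_mul_apply_single_eq {n : ℕ} (L : (Fin n → ℝ) →L[ℝ] ℝ) (x : Fin n → ℝ) :
    ∑ i, L (Pi.single i 1) * x i = L x := by
  conv_rhs => rw [← Finset.univ_sum_single x, map_sum]
  refine sum_congr rfl fun i _ => ?_
  rw [mul_comm, ← smul_eq_mul, ← map_smul, ← Pi.single_smul', smul_eq_mul, mul_one]

theorem norm_le_sqrt_sum_sq {n : ℕ} (x : Fin n → ℝ) : ‖x‖ ≤ Real.sqrt (∑ i, x i ^ 2) := by
  refine (pi_norm_le_iff_of_nonneg (Real.sqrt_nonneg _)).2 fun i => ?_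
  rw [Real.norm_eq_abs]
  exact Real.abs_le_sqrt (single_le_sum (f := fun i => x i ^ 2) (fun j _ => sq_nonneg _)
    (mem_univ i))

/-- Replacing the policy weights `w` by new ones changes the value function by a discounted
equation for the old transition matrix. -/
theorem policy_difference {S A : Type*} [Fintype S] [Fintype A] {γ : ℝ} {r : S → A → ℝ}
    {κ : S → A → S → ℝ} {w w' : S → A → ℝ} {V V' : S → ℝ}
    (hV : ∀ s, V s = ∑ a, w s a * (r s a + γ * ∑ s', κ s a s' * V s'))
    (hV' : ∀ s, V' s = ∑ a, w' s a * (r s a + γ * ∑ s', κ s a s' * V' s')) (s : S) :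
    V' s - V s = ∑ a, (w' s a - w s a) * (r s a + γ * ∑ s', κ s a s' * V' s') +
      γ * ∑ s', (∑ a, w s a * κ s a s') * (V' s' - V s') := by
  have h : γ * ∑ s', (∑ a, w s a * κ s a s') * (V' s' - V s') =
      ∑ a, w s a * (γ * ∑ s', κ s a s' * V' s' - γ * ∑ s', κ s a s' * V s') := by
    simp_rw [← mul_sub, ← sum_sub_distrib, sum_mul, mul_sum]
    rw [sum_comm]
    exact sum_congr rfl fun a _ => sum_congr rfl fun s' _ => by ring
  rw [h, hV' s, hV s, ← sum_sub_distrib, ← sum_add_distrib]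
  exact sum_congr rfl fun a _ => by ring

/-- Lemma 2 (policy supergradient): the vector
`g = (1/(1−γ)) Σ_s d_ρ^{π,κ_π}(s) Σ_a Q^π(s,a) ∇_θ π_θ(a|s)|_{θ₀}`
is a Fréchet supergradient of the robust objective
`J(θ) = min_{κ ∈ ⊗P_{s,a}} ρᵀ V_κ^{π_θ}` at `θ₀`, and it equals the analogous
expression with the robust advantage `A^π` in place of `Q^π`. -/
theorem stmt11 {S A : Type*} [Fintype S] [Fintype A] [DecidableEq S] {n : ℕ}
    (r : S → A → ℝ) (hr : ∀ s a, r s a ∈ Set.Icc (0 : ℝ) 1)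
    (γ : ℝ) (hγ0 : 0 < γ) (hγ1 : γ < 1)
    (Pset : S → A → Set (S → ℝ))
    (hPne : ∀ s a, (Pset s a).Nonempty)
    (hPcpt : ∀ s a, IsCompact (Pset s a))
    (hPprob : ∀ s a, ∀ p ∈ Pset s a, (∀ s', 0 ≤ p s') ∧ ∑ s', p s' = 1)
    (pol : (Fin n → ℝ) → S → A → ℝ)
    (hpol : ∀ θ s, (∀ a, 0 ≤ pol θ s a) ∧ ∑ a, pol θ s a = 1)
    (hdiff : ∀ s a, Differentiable ℝ (fun θ : Fin n → ℝ => pol θ s a))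
    (ρ : S → ℝ) (hρ0 : ∀ s, 0 ≤ ρ s) (hρ1 : ∑ s, ρ s = 1)
    (θ₀ : Fin n → ℝ)
    (κ : S → A → S → ℝ) (hκmem : ∀ s a, κ s a ∈ Pset s a)
    (Vπ : S → ℝ)
    (hVπ : ∀ s, Vπ s = ∑ a, pol θ₀ s a * (r s a + γ * ∑ s', κ s a s' * Vπ s'))
    (hκworst : ∀ s a, (∑ s', κ s a s' * Vπ s') =
      sInf {x : ℝ | ∃ p ∈ Pset s a, x = ∑ s', p s' * Vπ s'}) :
    let Pmat : (S → A → S → ℝ) → (Fin n → ℝ) → Matrix S S ℝ :=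
      fun k θ => Matrix.of fun s s' => ∑ a, pol θ s a * k s a s'
    let rpol : (Fin n → ℝ) → S → ℝ := fun θ s => ∑ a, pol θ s a * r s a
    let Vval : (S → A → S → ℝ) → (Fin n → ℝ) → S → ℝ :=
      fun k θ s => ∑' t : ℕ, γ ^ t * ((Pmat k θ ^ t) *ᵥ rpol θ) s
    let J : (Fin n → ℝ) → ℝ := fun θ =>
      sInf {x : ℝ | ∃ k : S → A → S → ℝ,
        (∀ s a, k s a ∈ Pset s a) ∧ x = ∑ s, ρ s * Vval k θ s}
    let Qπ : S → A → ℝ := fun s a => r s a + γ * ∑ s', κ s a s' * Vπ s'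
    let dvis : S → ℝ := fun s =>
      (1 - γ) * ∑' t : ℕ, γ ^ t * (((Pmat κ θ₀)ᵀ ^ t) *ᵥ ρ) s
    let g : Fin n → ℝ := fun i => (1 / (1 - γ)) * ∑ s, dvis s *
      ∑ a, Qπ s a * fderiv ℝ (fun θ => pol θ s a) θ₀ (Pi.single i 1)
    (Filter.limsup (fun θ : Fin n → ℝ =>
        (J θ - J θ₀ - ∑ i, g i * (θ i - θ₀ i)) /
          Real.sqrt (∑ i, (θ i - θ₀ i) ^ 2)) (nhdsWithin θ₀ {θ₀}ᶜ) ≤ 0) ∧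
      g = fun i => (1 / (1 - γ)) * ∑ s, dvis s *
        ∑ a, (Qπ s a - Vπ s) * fderiv ℝ (fun θ => pol θ s a) θ₀ (Pi.single i 1) := by
  intro Pmat rpol Vval J Qπ dvis g
  have hPst : ∀ k : S → A → S → ℝ, (∀ s a, k s a ∈ Pset s a) → ∀ θ,
      Pmat k θ ∈ rowStochastic ℝ S := by
    intro k hk θ
    rw [mem_rowStochastic_iff_sum]
    refine ⟨fun s s' => sum_nonneg fun a _ =>
      mul_nonneg ((hpol θ s).1 a) ((hPprob s a _ (hk s a)).1 s'), fun s => ?_⟩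
    simp only [Pmat, of_apply]
    rw [sum_comm]
    simp_rw [← mul_sum, (hPprob s _ _ (hk s _)).2, mul_one]
    exact (hpol θ s).2
  have hexp : ∀ k θ (V : S → ℝ) s, rpol θ s + γ * ∑ s', Pmat k θ s s' * V s' =
      ∑ a, pol θ s a * (r s a + γ * ∑ s', k s a s' * V s') := by
    intro k θ V s
    simp only [rpol, Pmat, of_apply, mul_add, sum_add_distrib, sum_mul, mul_sum]
    congr 1
    rw [sum_comm]
    exact sum_congr rfl fun s _ => sum_congr rfl fun s' _ => by ring
  have hVfix : ∀ k : S → A → S → ℝ, (∀ s a, k s a ∈ Pset s a) → ∀ θ s,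
      Vval k θ s = ∑ a, pol θ s a * (r s a + γ * ∑ s', k s a s' * Vval k θ s') := by
    intro k hk θ s
    rw [← hexp]
    exact tsum_discounted_eq (abs_pow_apply_le_one_of_mem_rowStochastic (hPst k hk θ))
      hγ0.le hγ1 _ s
  have hworst : ∀ s a, ∀ p ∈ Pset s a, ∑ s', κ s a s' * Vπ s' ≤ ∑ s', p s' * Vπ s' := by
    intro s a p hp
    rw [hκworst]
    refine csInf_le ?_ ⟨p, hp, rfl⟩
    have hc : Continuous fun p : S → ℝ => ∑ s', p s' * Vπ s' := by fun_prop
    have hb := ((hPcpt s a).image hc).bddBelow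
    refine hb.mono ?_
    rintro _ ⟨q, hq, rfl⟩
    exact ⟨q, hq, rfl⟩
  have hVmin : ∀ k : S → A → S → ℝ, (∀ s a, k s a ∈ Pset s a) → ∀ s, Vπ s ≤ Vval k θ₀ s := by
    intro k hk s
    have h := le_div_of_le_add_discounted (hPst k hk θ₀) hγ0.le hγ1
      (D := fun s => Vπ s - Vval k θ₀ s) (c := 0) (fun s => ?_) s
    · simpa using h
    · have h1 : Vπ s ≤ rpol θ₀ s + γ * ∑ s', Pmat k θ₀ s s' * Vπ s' := by
        rw [hexp, hVπ s]
        exact sum_le_sum fun a _ => mul_le_mul_of_nonneg_left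
          (add_le_add_right (mul_le_mul_of_nonneg_left (hworst s a _ (hk s a)) hγ0.le) _)
          ((hpol θ₀ s).1 a)
      have h2 := hVfix k hk θ₀ s
      rw [← hexp] at h2
      simp only [mul_sub, sum_sub_distrib]
      linarith
  have hVeq : ∀ s, Vval κ θ₀ s = Vπ s := by
    intro s
    refine le_antisymm ?_ (hVmin κ hκmem s)
    have h := le_div_of_le_add_discounted (hPst κ hκmem θ₀) hγ0.le hγ1
      (D := fun s => Vval κ θ₀ s - Vπ s) (c := 0) (fun s => ?_) s
    · simpa using h
    · have h1 := hVπ s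
      have h2 := hVfix κ hκmem θ₀ s
      rw [← hexp] at h1 h2
      simp only [mul_sub, sum_sub_distrib]
      linarith
  have hVnn : ∀ k : S → A → S → ℝ, (∀ s a, k s a ∈ Pset s a) → ∀ θ s, 0 ≤ Vval k θ s := by
    intro k hk θ s
    refine tsum_nonneg fun t => mul_nonneg (pow_nonneg hγ0.le t) (sum_nonneg fun s' _ =>
      mul_nonneg (nonneg_of_mem_rowStochastic (pow_mem (hPst k hk θ) t)) (sum_nonneg fun a _ =>
        mul_nonneg ((hpol θ s').1 a) (hr s' a).1))
  have hJle : ∀ θ, J θ ≤ ∑ s, ρ s * Vval κ θ s := by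
    intro θ
    refine csInf_le ⟨0, ?_⟩ ⟨κ, hκmem, rfl⟩
    rintro _ ⟨k, hk, rfl⟩
    exact sum_nonneg fun s _ => mul_nonneg (hρ0 s) (hVnn k hk θ s)
  have hJ0 : ∑ s, ρ s * Vπ s ≤ J θ₀ := by
    refine le_csInf ⟨_, κ, hκmem, rfl⟩ ?_
    rintro _ ⟨k, hk, rfl⟩
    exact sum_le_sum fun s _ => mul_le_mul_of_nonneg_left (hVmin k hk s) (hρ0 s)
  set d : S → ℝ := fun s => ∑' t : ℕ, γ ^ t * (((Pmat κ θ₀)ᵀ ^ t) *ᵥ ρ) s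
  have hdfix : ∀ s, d s = ρ s + γ * ∑ s', Pmat κ θ₀ s' s * d s' := fun s =>
    tsum_discounted_eq (M := (Pmat κ θ₀)ᵀ) (fun t i j => by
      rw [← transpose_pow]
      exact abs_pow_apply_le_one_of_mem_rowStochastic (hPst κ hκmem θ₀) t j i) hγ0.le hγ1 ρ s
  have hdiff_eq : ∀ θ, ∑ s, ρ s * Vval κ θ s - ∑ s, ρ s * Vπ s =
      ∑ s, d s * ∑ a, (pol θ s a - pol θ₀ s a) *
        (r s a + γ * ∑ s', κ s a s' * Vval κ θ s') := by
    intro θ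
    rw [← sum_sub_distrib, ← sum_mul_eq_sum_mul_of_discounted hdfix
      (policy_difference hVπ (hVfix κ hκmem θ))]
    exact sum_congr rfl fun s _ => by ring
  have hVcont : ∀ s, ContinuousAt (fun θ => Vval κ θ s) θ₀ := by
    let c : (Fin n → ℝ) → ℝ := fun θ => ∑ s, |∑ a, (pol θ₀ s a - pol θ s a) * Qπ s a|
    have hc : Tendsto c (𝓝 θ₀) (𝓝 0) := by
      have hcont : Continuous c := by
        have := fun s a => (hdiff s a).continuous
        fun_prop
      simpa [c] using hcont.tendsto θ₀
    have hbase : ∀ θ s, Vπ s - Vval κ θ s = ∑ a, (pol θ₀ s a - pol θ s a) * Qπ s a +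
        γ * ∑ s', Pmat κ θ s s' * (Vπ s' - Vval κ θ s') := fun θ s =>
      policy_difference (hVfix κ hκmem θ) hVπ s
    have hcs : ∀ θ s, |∑ a, (pol θ₀ s a - pol θ s a) * Qπ s a| ≤ c θ := fun θ s =>
      single_le_sum (f := fun s => |∑ a, (pol θ₀ s a - pol θ s a) * Qπ s a|)
        (fun _ _ => abs_nonneg _) (mem_univ s)
    intro s
    rw [ContinuousAt, hVeq s, tendsto_iff_dist_tendsto_zero]
    refine squeeze_zero (fun _ => dist_nonneg) (fun θ => ?_)
      (by simpa using hc.div_const (1 - γ))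
    rw [Real.dist_eq, abs_le']
    constructor
    · refine le_div_of_le_add_discounted (hPst κ hκmem θ) hγ0.le hγ1
        (D := fun s => Vval κ θ s - Vπ s) (fun s => ?_) s
      have h1 := hbase θ s
      have h2 := (neg_le_abs _).trans (hcs θ s)
      simp only [mul_sub, sum_sub_distrib] at h1 h2 ⊢
      linarith
    · rw [neg_sub]
      refine le_div_of_le_add_discounted (hPst κ hκmem θ) hγ0.le hγ1
        (D := fun s => Vπ s - Vval κ θ s) (fun s => ?_) s
      have h1 := hbase θ s
      have h2 := (le_abs_self _).trans (hcs θ s)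
      linarith
  let L : (Fin n → ℝ) →L[ℝ] ℝ :=
    ∑ s, d s • ∑ a, Qπ s a • fderiv ℝ (fun θ => pol θ s a) θ₀
  have hL : HasFDerivAt (fun θ => ∑ s, ρ s * Vval κ θ s - ∑ s, ρ s * Vπ s) L θ₀ := by
    simp_rw [hdiff_eq]
    refine HasFDerivAt.fun_sum fun s _ => HasFDerivAt.const_mul
      (HasFDerivAt.fun_sum fun a _ => ?_) (d s)
    have h := HasFDerivAt.mul_continuousAt_of_eq_zero
      (h := fun θ => r s a + γ * ∑ s', κ s a s' * Vval κ θ s')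
      (((hdiff s a) θ₀).hasFDerivAt.sub_const (pol θ₀ s a)) (sub_self _) (by fun_prop)
    simpa only [hVeq] using h
  have hgL : ∀ i, g i = L (Pi.single i 1) := by
    intro i
    have hne : 1 - γ ≠ 0 := by linarith
    simp only [g, L, dvis, _root_.sum_apply, _root_.smul_apply,
      smul_eq_mul, mul_assoc, ← mul_sum]
    field_simp
    rfl
  refine ⟨Real.limsup_le_zero_of_forall_eventually_le fun ε hε => ?_, ?_⟩
  · have ho := (hasFDerivAt_iff_isLittleO.1 hL).def hε
    filter_upwards [nhdsWithin_le_nhds ho] with θ hθ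
    simp_rw [hgL]
    have hsum : ∑ i, L (Pi.single i 1) * (θ i - θ₀ i) = L (θ - θ₀) :=
      sum_mul_apply_single_eq L (θ - θ₀)
    rw [hsum]
    refine div_le_of_le_mul₀ (Real.sqrt_nonneg _) hε.le ?_
    have h1 := mul_le_mul_of_nonneg_left (norm_le_sqrt_sum_sq (θ - θ₀)) hε.le
    have h2 := (Real.le_norm_self _).trans hθ
    simp only [hVeq, sub_self, sub_zero, Pi.sub_apply] at h1 h2
    linarith [hJle θ]
  · have hzero : ∀ s, ∑ a, fderiv ℝ (fun θ => pol θ s a) θ₀ = 0 := by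
      intro s
      rw [← fderiv_fun_sum fun a _ => (hdiff s a) θ₀]
      simp_rw [(hpol _ s).2]
      exact fderiv_const_apply _
    funext i
    simp only [g]
    congr 1
    refine sum_congr rfl fun s _ => ?_
    have h := congrArg (fun f : (Fin n → ℝ) →L[ℝ] ℝ => f (Pi.single i 1)) (hzero s)
    simp only [_root_.sum_apply, _root_.zero_apply] at h
    simp_rw [sub_mul, sum_sub_distrib, ← mul_sum, h, mul_zero, sub_zero]
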